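/- Let C₁, C₂, γ > 0 and let (t_n)_{n≥1} be a sequence of reals with C₁ n^γ ≤ t_n ≤ C₂ n^γ for all n ≥ 1. Then there exist C > 0 and an integer n₀ such that the set of real ξ satisfying ‖ξ t_n‖ > C/(n log n) for all n ≥ n₀ has full Hausdorff dimension. -/

import Mathlib

open MeasureTheory Set

noncomputable def nint (y : ℝ) : ℝ := |y - round y|

/-- `G` changes membership only across at most `M` cut points. -/
def HasCuts (G : Set ℝ) (M : ℕ) : Prop :=
  ∃ P : Finset ℝ, P.card ≤ M ∧
    ∀ x y, x ≤ y → (∀ p ∈ P, ¬ (x ≤ p ∧ p ≤ y)) → (x ∈ G ↔ y ∈ G)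

lemma HasCuts.empty : HasCuts ∅ 0 := ⟨∅, by simp, by simp⟩

lemma HasCuts.mono {G : Set ℝ} {M N : ℕ} (h : HasCuts G M) (hMN : M ≤ N) : HasCuts G N := by
  obtain ⟨P, hP, h⟩ := h
  exact ⟨P, hP.trans hMN, h⟩

lemma hasCuts_Icc (a b : ℝ) : HasCuts (Icc a b) 2 := by
  refine ⟨{a, b}, Finset.card_le_two, fun x y hxy h => ?_⟩
  have ha := h a (by simp)
  have hb := h b (by simp)
  simp only [mem_Icc]
  grind

lemma hasCuts_Ioo (a b : ℝ) : HasCuts (Ioo a b) 2 := by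
  refine ⟨{a, b}, Finset.card_le_two, fun x y hxy h => ?_⟩
  have ha := h a (by simp)
  have hb := h b (by simp)
  simp only [mem_Ioo]
  grind

lemma HasCuts.union {G H : Set ℝ} {M N : ℕ} (h : HasCuts G M) (h' : HasCuts H N) :
    HasCuts (G ∪ H) (M + N) := by
  obtain ⟨P, hP, h⟩ := h
  obtain ⟨Q, hQ, h'⟩ := h'
  refine ⟨P ∪ Q, (Finset.card_union_le _ _).trans (by omega), fun x y hxy hp => ?_⟩
  have h1 := h x y hxy (fun p hpp => hp p (by simp [hpp]))
  have h2 := h' x y hxy (fun p hpp => hp p (by simp [hpp]))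
  simp only [mem_union, h1, h2]

lemma HasCuts.diff {G H : Set ℝ} {M N : ℕ} (h : HasCuts G M) (h' : HasCuts H N) :
    HasCuts (G \ H) (M + N) := by
  obtain ⟨P, hP, h⟩ := h
  obtain ⟨Q, hQ, h'⟩ := h'
  refine ⟨P ∪ Q, (Finset.card_union_le _ _).trans (by omega), fun x y hxy hp => ?_⟩
  have h1 := h x y hxy (fun p hpp => hp p (by simp [hpp]))
  have h2 := h' x y hxy (fun p hpp => hp p (by simp [hpp]))
  simp only [mem_sdiff, h1, h2]

lemma HasCuts.biUnion {ι : Type*} (F : Finset ι) (S : ι → Set ℝ) (M : ι → ℕ)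
    (h : ∀ i ∈ F, HasCuts (S i) (M i)) : HasCuts (⋃ i ∈ F, S i) (∑ i ∈ F, M i) := by
  classical
  induction F using Finset.induction_on with
  | empty => simpa using HasCuts.empty
  | insert a F ha ih =>
    rw [Finset.sum_insert ha, Finset.set_biUnion_insert]
    exact (h a (by simp)).union (ih fun i hi => h i (by simp [hi]))

/-- The bad set. -/
def Bad (t e : ℝ) : Set ℝ := {x | nint (x * t) < e}

lemma mem_bad_iff {t e x : ℝ} : x ∈ Bad t e ↔ ∃ j : ℤ, |x * t - j| < e := by
  constructor
  · intro h
    exact ⟨round (x * t), h⟩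
  · rintro ⟨j, hj⟩
    exact (round_le (x * t) j).trans_lt hj

lemma isOpen_bad (t e : ℝ) : IsOpen (Bad t e) := by
  have : Bad t e = ⋃ j : ℤ, {x : ℝ | |x * t - j| < e} := by
    ext x; simp [mem_bad_iff]
  rw [this]
  exact isOpen_iUnion fun j => isOpen_lt (by fun_prop) continuous_const

lemma bad_Icc_eq {t e : ℝ} (ht : 0 < t) (he : e ≤ 1) {x : ℝ} (hx : x ∈ Icc (0:ℝ) 1) :
    x ∈ Bad t e ↔ x ∈ ⋃ j ∈ Finset.range (⌊t⌋₊ + 2), Ioo (((j:ℝ) - e) / t) ((j + e) / t) := by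
  have key : ∀ j : ℝ, |x * t - j| < e ↔ x ∈ Ioo ((j - e) / t) ((j + e) / t) := by
    intro j
    rw [mem_Ioo, div_lt_iff₀ ht, lt_div_iff₀ ht, abs_lt]
    constructor <;> rintro ⟨h1, h2⟩ <;> constructor <;> linarith
  rw [mem_bad_iff]
  simp only [mem_iUnion, Finset.mem_range, exists_prop]
  constructor
  · rintro ⟨j, hj⟩
    have hj' := abs_lt.1 hj
    have h0 : 0 ≤ x * t := mul_nonneg hx.1 ht.le
    have h1 : x * t ≤ t := mul_le_of_le_one_left ht.le hx.2
    have hj0 : 0 ≤ j := by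
      have : (-1 : ℝ) < j := by linarith
      have : (-1 : ℤ) < j := by exact_mod_cast this
      omega
    lift j to ℕ using hj0
    refine ⟨j, ?_, (key _).1 (by simpa using hj)⟩
    have h2 := Nat.lt_floor_add_one t
    have : (j : ℝ) < (⌊t⌋₊ + 2 : ℕ) := by
      push_cast at hj' ⊢
      linarith
    exact_mod_cast this
  · rintro ⟨j, -, hj⟩
    exact ⟨j, by simpa using (key _).2 hj⟩

lemma volume_bad_le {t e : ℝ} (ht : 0 < t) (he : 0 ≤ e) {G : Set ℝ} (hG : MeasurableSet G)
    {M : ℕ} (hc : HasCuts G M) :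
    volume (Bad t e ∩ G) ≤ ENNReal.ofReal (2 * e) * volume G + ENNReal.ofReal (2 * e / t) * M := by
  classical
  obtain ⟨P, hPM, hP⟩ := hc
  set cell : ℤ → Set ℝ := fun j => {x | round (x * t) = j} with hcell
  have hcell' : ∀ j, cell j = Ico (((j:ℝ) - 1 / 2) / t) ((j + 1 / 2) / t) := by
    intro j
    ext x
    simp only [hcell, mem_ofPred_eq, mem_Ico, round_eq, Int.floor_eq_iff]
    rw [div_le_iff₀ ht, lt_div_iff₀ ht]
    constructor <;> rintro ⟨h1, h2⟩ <;> constructor <;> linarith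
  have hmeas : ∀ j, MeasurableSet (cell j) := fun j => by rw [hcell']; exact measurableSet_Ico
  have hdisj : Pairwise (Function.onFun Disjoint cell) := by
    intro i j hij
    refine Set.disjoint_left.2 fun x hx hx' => hij ?_
    exact hx.symm.trans hx'
  have hun : ⋃ j, cell j = univ := by
    ext x; simp [hcell]
  have hvol : ∀ j, volume (cell j) = ENNReal.ofReal (1 / t) := by
    intro j
    rw [hcell', Real.volume_Ico]
    congr 1
    field_simp
    ring
  have hbad : ∀ j, volume (Bad t e ∩ cell j) ≤ ENNReal.ofReal (2 * e / t) := by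
    intro j
    have : Bad t e ∩ cell j ⊆ Icc (((j:ℝ) - e) / t) ((j + e) / t) := by
      rintro x ⟨hx, hxj⟩
      have hx : |x * t - round (x * t)| < e := hx
      have hxj : round (x * t) = j := hxj
      rw [hxj, abs_lt] at hx
      rw [mem_Icc, div_le_iff₀ ht, le_div_iff₀ ht]
      constructor <;> linarith
    refine (measure_mono this).trans ?_
    rw [Real.volume_Icc]
    refine ENNReal.ofReal_le_ofReal (le_of_eq ?_)
    field_simp
    ring
  set ν : Measure ℝ := ∑ p ∈ P, Measure.dirac p with hν
  have hνu : ν univ = P.card := by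
    simp [hν]
  have hcellν : ∀ j, volume ((Bad t e ∩ G) ∩ cell j) ≤
      ENNReal.ofReal (2 * e) * volume (G ∩ cell j) + ENNReal.ofReal (2 * e / t) * ν (cell j) := by
    intro j
    by_cases hp : ∃ p ∈ P, p ∈ cell j
    · obtain ⟨p, hpP, hpj⟩ := hp
      have h1 : 1 ≤ ν (cell j) := by
        rw [hν, Measure.finsetSum_apply]
        calc (1 : ENNReal) = Measure.dirac p (cell j) := by
              rw [Measure.dirac_apply' _ (hmeas j)]; simp [hpj]
          _ ≤ _ := Finset.single_le_sum (f := fun p => Measure.dirac p (cell j))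
              (fun _ _ => zero_le) hpP
      calc volume ((Bad t e ∩ G) ∩ cell j) ≤ volume (Bad t e ∩ cell j) :=
            measure_mono (by intro x hx; exact ⟨hx.1.1, hx.2⟩)
        _ ≤ ENNReal.ofReal (2 * e / t) := hbad j
        _ ≤ ENNReal.ofReal (2 * e / t) * ν (cell j) := le_mul_of_one_le_right' h1
        _ ≤ _ := le_add_self
    · push Not at hp
      by_cases hne : (G ∩ cell j).Nonempty
      · obtain ⟨x, hxG, hxj⟩ := hne
        have hsub : cell j ⊆ G := by
          intro y hy
          have hoc : ∀ a b p, a ∈ cell j → b ∈ cell j → a ≤ p → p ≤ b → p ∈ cell j := by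
            intro a b p ha hb hap hpb
            rw [hcell'] at *
            exact ⟨ha.1.trans hap, hpb.trans_lt hb.2⟩
          rcases le_total x y with hxy | hxy
          · exact (hP x y hxy fun p hpP hh => hp p hpP (hoc x y p hxj hy hh.1 hh.2)).1 hxG
          · exact (hP y x hxy fun p hpP hh => hp p hpP (hoc y x p hy hxj hh.1 hh.2)).2 hxG
        calc volume ((Bad t e ∩ G) ∩ cell j) ≤ volume (Bad t e ∩ cell j) :=
            measure_mono (by intro x hx; exact ⟨hx.1.1, hx.2⟩)
          _ ≤ ENNReal.ofReal (2 * e / t) := hbad j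
          _ = ENNReal.ofReal (2 * e) * volume (G ∩ cell j) := by
            rw [inter_eq_right.2 hsub, hvol, ← ENNReal.ofReal_mul (by positivity)]
            congr 1
            ring
          _ ≤ _ := le_self_add
      · have : (Bad t e ∩ G) ∩ cell j = ∅ := by
          rw [inter_assoc, not_nonempty_iff_eq_empty.1 hne, inter_empty]
        rw [this]; simp
  have hsum : ∀ (μ : Measure ℝ) (S : Set ℝ), MeasurableSet S → μ S = ∑' j, μ (S ∩ cell j) := by
    intro μ S hS
    rw [← measure_iUnion (fun i j hij => (hdisj hij).mono inter_subset_right inter_subset_right)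
      (fun j => hS.inter (hmeas j)), ← inter_iUnion, hun, inter_univ]
  have hνs : ∑' j, ν (cell j) = P.card := by
    rw [← hνu, hsum ν univ MeasurableSet.univ]
    simp
  calc volume (Bad t e ∩ G) = ∑' j, volume ((Bad t e ∩ G) ∩ cell j) :=
        hsum _ _ ((isOpen_bad t e).measurableSet.inter hG)
    _ ≤ ∑' j, (ENNReal.ofReal (2 * e) * volume (G ∩ cell j)
          + ENNReal.ofReal (2 * e / t) * ν (cell j)) := ENNReal.tsum_le_tsum hcellν
    _ = ENNReal.ofReal (2 * e) * volume G + ENNReal.ofReal (2 * e / t) * P.card := by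
        rw [ENNReal.tsum_add, ENNReal.tsum_mul_left, ENNReal.tsum_mul_left, hνs, ← hsum _ _ hG]
    _ ≤ _ := by gcongr

lemma real_bad_le {t e : ℝ} (ht : 0 < t) (he : 0 ≤ e) {G : Set ℝ} (hG : MeasurableSet G)
    (hfin : volume G ≠ ⊤) {M : ℕ} (hc : HasCuts G M) :
    volume.real (Bad t e ∩ G) ≤ 2 * e * volume.real G + 2 * e / t * M := by
  have h := volume_bad_le ht he hG hc
  have h' := ENNReal.toReal_mono (by finiteness) h
  rw [ENNReal.toReal_add (by finiteness) (by finiteness), ENNReal.toReal_mul, ENNReal.toReal_mul,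
    ENNReal.toReal_ofReal (by positivity), ENNReal.toReal_ofReal (by positivity)] at h'
  simpa [Measure.real] using h'

lemma core (t e : ℕ → ℝ) (N : ℕ → ℕ) (hN : Monotone N) (x ρ : ℕ → ℝ) (hρ : ∀ i, 0 ≤ ρ i)
    (F : ℕ → Finset ℕ) (hF : Monotone F) (hF1 : F 1 = ∅)
    (ht : ∀ n, N 1 ≤ n → 0 < t n) (he : ∀ n, N 1 ≤ n → 0 ≤ e n ∧ e n ≤ 1)
    (T : ℕ → ℝ) (hT0 : ∀ k, 0 < T k) (hT : ∀ k n, N (k + 1) ≤ n → T k ≤ t n)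
    (hS : ∀ k, ∑ n ∈ Finset.Ico (N (k + 1)) (N (k + 2)), e n ≤ 1 / 24)
    (hM : ∀ k, ((2 + ((∑ n ∈ Finset.Ico (N 1) (N k), (⌊t n⌋₊ + 2) * 2) + (F k).card * 2) : ℕ) : ℝ)
      ≤ T k * (1 / 2) ^ (k + 1))
    (hV : ∀ k, ∑ i ∈ F (k + 2) \ F (k + 1), 2 * ρ i ≤ (1 / 2 : ℝ) ^ (k + 3)) :
    ∃ ξ ∈ Icc (0:ℝ) 1, (∀ k, ∀ n ∈ Finset.Ico (N 1) (N k), ξ ∉ Bad (t n) (e n)) ∧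
      ∀ k, ∀ i ∈ F k, ξ ∉ Ioo (x i - ρ i) (x i + ρ i) := by
  classical
  have hF0 : F 0 = ∅ := by
    have := hF (zero_le_one)
    rw [hF1] at this
    exact Finset.subset_empty.1 this
  set R : ℕ → Set ℝ := fun k => (⋃ n ∈ Finset.Ico (N 1) (N k), Bad (t n) (e n)) ∪
    ⋃ i ∈ F k, Ioo (x i - ρ i) (x i + ρ i) with hR
  set G : ℕ → Set ℝ := fun k => Icc (0:ℝ) 1 \ R k with hG
  have hRopen : ∀ k, IsOpen (R k) := fun k =>
    (isOpen_biUnion fun n _ => isOpen_bad _ _).union (isOpen_biUnion fun i _ => isOpen_Ioo)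
  have hGcl : ∀ k, IsClosed (G k) := fun k => isClosed_Icc.sdiff (hRopen k)
  have hGm : ∀ k, MeasurableSet (G k) := fun k => (hGcl k).measurableSet
  have hGfin : ∀ k, volume (G k) ≠ ⊤ := fun k =>
    measure_ne_top_of_subset sdiff_subset (by simp)
  have hGcuts : ∀ k, HasCuts (G k)
      (2 + ((∑ n ∈ Finset.Ico (N 1) (N k), (⌊t n⌋₊ + 2) * 2) + (F k).card * 2)) := by
    intro k
    have hGe : G k = Icc (0:ℝ) 1 \ ((⋃ n ∈ Finset.Ico (N 1) (N k),
        ⋃ j ∈ Finset.range (⌊t n⌋₊ + 2), Ioo (((j:ℝ) - e n) / t n) ((j + e n) / t n)) ∪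
        ⋃ i ∈ F k, Ioo (x i - ρ i) (x i + ρ i)) := by
      ext y
      simp only [hG, hR, mem_sdiff, mem_union]
      refine and_congr_right fun hy => not_congr (or_congr_left ?_)
      rw [mem_iUnion₂, mem_iUnion₂]
      refine exists_congr fun n => exists_congr fun hn => ?_
      have hn := (Finset.mem_Ico.1 hn).1
      exact bad_Icc_eq (ht n hn) (he n hn).2 hy
    rw [hGe]
    refine (hasCuts_Icc 0 1).diff (HasCuts.union (HasCuts.biUnion _ _ _ fun n _ => ?_) ?_)
    · have := HasCuts.biUnion (Finset.range (⌊t n⌋₊ + 2))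
        (fun j : ℕ => Ioo (((j:ℝ) - e n) / t n) ((j + e n) / t n)) (fun _ => 2)
        (fun j _ => hasCuts_Ioo _ _)
      simpa using this
    · have := HasCuts.biUnion (F k) (fun i => Ioo (x i - ρ i) (x i + ρ i)) (fun _ => 2)
        (fun j _ => hasCuts_Ioo _ _)
      simpa using this
  have hRmono : ∀ k, R k ⊆ R (k + 1) := by
    intro k
    refine union_subset_union ?_ ?_
    · refine biUnion_subset_biUnion_left ?_
      intro n hn
      have := hN (Nat.le_succ k)
      have hn : n ∈ Finset.Ico (N 1) (N k) := hn
      have hn' := Finset.mem_Ico.1 hn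
      exact Finset.mem_Ico.2 ⟨hn'.1, hn'.2.trans_le this⟩
    · exact biUnion_subset_biUnion_left (fun i hi => hF (Nat.le_succ k) hi)
  have hGanti : ∀ k, G (k + 1) ⊆ G k := fun k => sdiff_subset_sdiff_right (hRmono k)
  have hR1 : R 1 = ∅ := by simp [hR, hF1]
  have hR0 : R 0 = ∅ := subset_empty_iff.1 (hR1 ▸ hRmono 0)
  have hg : ∀ k, (1 / 2 : ℝ) ^ k ≤ volume.real (G k) ∧
      volume.real (G k) / 2 ≤ volume.real (G (k + 1)) := by
    intro k
    induction k with
    | zero => simp [hG, hR0, hR1]; norm_num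
    | succ k ih =>
      obtain ⟨ih1, ih2⟩ := ih
      have h1 : (1 / 2 : ℝ) ^ (k + 1) ≤ volume.real (G (k + 1)) := by
        rw [pow_succ]; linarith
      refine ⟨h1, ?_⟩
      have hsub : G (k + 1) ⊆ G (k + 2) ∪
          ((⋃ n ∈ Finset.Ico (N (k + 1)) (N (k + 2)), (Bad (t n) (e n) ∩ G k)) ∪
          ⋃ i ∈ F (k + 2) \ F (k + 1), Ioo (x i - ρ i) (x i + ρ i)) := by
        intro y hy
        by_cases hy2 : y ∈ R (k + 2)
        · right
          rcases hy2 with hy2 | hy2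
          · left
            obtain ⟨n, hn, hyn⟩ := mem_iUnion₂.1 hy2
            refine mem_iUnion₂.2 ⟨n, ?_, hyn, hGanti k hy⟩
            rw [Finset.mem_Ico] at hn ⊢
            refine ⟨?_, hn.2⟩
            by_contra hlt
            exact hy.2 (Or.inl (mem_iUnion₂.2 ⟨n, Finset.mem_Ico.2 ⟨hn.1, by omega⟩, hyn⟩))
          · right
            obtain ⟨i, hi, hyi⟩ := mem_iUnion₂.1 hy2
            refine mem_iUnion₂.2 ⟨i, ?_, hyi⟩
            rw [Finset.mem_sdiff]
            refine ⟨hi, fun hi' => hy.2 (Or.inr (mem_iUnion₂.2 ⟨i, hi', hyi⟩))⟩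
        · left
          exact ⟨hy.1, hy2⟩
      set M : ℝ := ((2 + ((∑ n ∈ Finset.Ico (N 1) (N k), (⌊t n⌋₊ + 2) * 2)
        + (F k).card * 2) : ℕ) : ℝ) with hMdef
      have hb : ∑ n ∈ Finset.Ico (N (k + 1)) (N (k + 2)), volume.real (Bad (t n) (e n) ∩ G k)
          ≤ volume.real (G (k + 1)) / 4 := by
        have hn1 : ∀ n ∈ Finset.Ico (N (k + 1)) (N (k + 2)), volume.real (Bad (t n) (e n) ∩ G k)
            ≤ e n * (6 * volume.real (G (k + 1))) := by
          intro n hn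
          have hn := (Finset.mem_Ico.1 hn).1
          have hn' : N 1 ≤ n := (hN (by omega)).trans hn
          have hb := real_bad_le (ht n hn') (he n hn').1 (hGm k) (hGfin k) (hGcuts k)
          rw [← hMdef] at hb
          have hMt : M / t n ≤ volume.real (G (k + 1)) := by
            rw [div_le_iff₀ (ht n hn')]
            calc M ≤ T k * (1 / 2) ^ (k + 1) := hM k
              _ ≤ t n * volume.real (G (k + 1)) := by
                gcongr
                · exact (ht n hn').le
                · exact hT k n hn
              _ = _ := mul_comm _ _
          have he0 := (he n hn').1
          calc volume.real (Bad (t n) (e n) ∩ G k)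
              ≤ 2 * e n * volume.real (G k) + 2 * e n / t n * M := hb
            _ = e n * (2 * volume.real (G k) + 2 * (M / t n)) := by ring
            _ ≤ e n * (6 * volume.real (G (k + 1))) := by
                gcongr
                linarith
        refine (Finset.sum_le_sum hn1).trans ?_
        rw [← Finset.sum_mul]
        have := mul_le_mul_of_nonneg_right (hS k)
          (show 0 ≤ 6 * volume.real (G (k + 1)) by positivity)
        linarith
      have hv : ∑ i ∈ F (k + 2) \ F (k + 1), volume.real (Ioo (x i - ρ i) (x i + ρ i))
          ≤ volume.real (G (k + 1)) / 4 := by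
        have : ∀ i, volume.real (Ioo (x i - ρ i) (x i + ρ i)) = 2 * ρ i := by
          intro i
          rw [Real.volume_real_Ioo_of_le (by linarith [hρ i])]; ring
        simp only [this]
        have h2 := hV k
        have h3 : (1 / 2 : ℝ) ^ (k + 3) = (1 / 2) ^ (k + 1) / 4 := by ring
        linarith
      have hfin1 : volume (⋃ n ∈ Finset.Ico (N (k + 1)) (N (k + 2)), (Bad (t n) (e n) ∩ G k)) ≠ ⊤ :=
        measure_ne_top_of_subset (iUnion₂_subset fun n _ => inter_subset_right) (hGfin k)
      have hfin2 : volume (⋃ i ∈ F (k + 2) \ F (k + 1), Ioo (x i - ρ i) (x i + ρ i)) ≠ ⊤ := by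
        refine ((measure_biUnion_finset_le _ _).trans_lt ?_).ne
        exact ENNReal.sum_lt_top.2 fun i _ => by simp
      have h4 := measureReal_mono (μ := volume) hsub
        (measure_union_ne_top (hGfin _) (measure_union_ne_top hfin1 hfin2))
      have h5 := measureReal_union_le (μ := volume) (G (k + 2))
        ((⋃ n ∈ Finset.Ico (N (k + 1)) (N (k + 2)), (Bad (t n) (e n) ∩ G k)) ∪
          ⋃ i ∈ F (k + 2) \ F (k + 1), Ioo (x i - ρ i) (x i + ρ i))
      have h6 := measureReal_union_le (μ := volume)
        (⋃ n ∈ Finset.Ico (N (k + 1)) (N (k + 2)), (Bad (t n) (e n) ∩ G k))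
          (⋃ i ∈ F (k + 2) \ F (k + 1), Ioo (x i - ρ i) (x i + ρ i))
      have h7 := measureReal_biUnion_finset_le (μ := volume)
        (Finset.Ico (N (k + 1)) (N (k + 2))) (fun n => Bad (t n) (e n) ∩ G k)
      have h8 := measureReal_biUnion_finset_le (μ := volume)
        (F (k + 2) \ F (k + 1)) (fun i => Ioo (x i - ρ i) (x i + ρ i))
      change volume.real (G (k + 1)) / 2 ≤ volume.real (G (k + 2))
      linarith
  have hne : (⋂ k, G k).Nonempty := by
    refine IsCompact.nonempty_iInter_of_sequence_nonempty_isCompact_isClosed G hGanti ?_ ?_ hGcl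
    · intro k
      by_contra h
      rw [not_nonempty_iff_eq_empty] at h
      have := (hg k).1
      rw [h] at this
      rw [measureReal_empty] at this
      have h2 : (0:ℝ) < (1 / 2) ^ k := by positivity
      linarith
    · exact isCompact_Icc.of_isClosed_subset (hGcl 0) sdiff_subset
  obtain ⟨ξ, hξ⟩ := hne
  rw [mem_iInter] at hξ
  refine ⟨ξ, (hξ 0).1, fun k n hn hb => (hξ k).2 (Or.inl (mem_iUnion₂.2 ⟨n, hn, hb⟩)),
    fun k i hi hb => (hξ k).2 (Or.inr (mem_iUnion₂.2 ⟨i, hi, hb⟩))⟩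

lemma sum_inv_mul_log (u h : ℕ) (hu : 1 ≤ u) :
    ∑ n ∈ Finset.Ico (2 ^ u : ℕ) (2 ^ (u * h)), 1 / ((n : ℝ) * Real.log n) ≤ h + 2 := by
  have hl2 := Real.log_two_gt_d9
  have hu' : (1:ℝ) ≤ u := by exact_mod_cast hu
  have hpos : 0 < u * Real.log 2 := by positivity
  calc ∑ n ∈ Finset.Ico (2 ^ u : ℕ) (2 ^ (u * h)), 1 / ((n : ℝ) * Real.log n)
      ≤ ∑ n ∈ Finset.Ico (2 ^ u : ℕ) (2 ^ (u * h)), (n : ℝ)⁻¹ * (u * Real.log 2)⁻¹ := by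
        refine Finset.sum_le_sum fun n hn => ?_
        have hn := (Finset.mem_Ico.1 hn).1
        have hn' : (2:ℝ) ^ u ≤ n := by exact_mod_cast hn
        have hn0 : (0:ℝ) < n := lt_of_lt_of_le (by positivity) hn'
        have : u * Real.log 2 ≤ Real.log n := by
          rw [← Real.log_pow]; exact Real.log_le_log (by positivity) hn'
        rw [one_div, mul_inv]
        gcongr
    _ = (∑ n ∈ Finset.Ico (2 ^ u : ℕ) (2 ^ (u * h)), (n : ℝ)⁻¹) * (u * Real.log 2)⁻¹ := by
        rw [Finset.sum_mul]
    _ ≤ (∑ n ∈ Finset.Icc (1 : ℕ) (2 ^ (u * h)), (n : ℝ)⁻¹) * (u * Real.log 2)⁻¹ := by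
        gcongr
        intro n hn
        rw [Finset.mem_Ico] at hn
        rw [Finset.mem_Icc]
        exact ⟨Nat.one_le_two_pow.trans hn.1, hn.2.le⟩
    _ ≤ (1 + u * h * Real.log 2) * (u * Real.log 2)⁻¹ := by
        gcongr
        have := harmonic_le_one_add_log (2 ^ (u * h))
        rw [harmonic_eq_sum_Icc] at this
        push_cast at this
        rw [Real.log_pow] at this
        push_cast at this
        exact this
    _ ≤ h + 2 := by
        rw [← div_eq_mul_inv, div_le_iff₀ hpos]
        nlinarith

lemma cuts_bound {C₁ C₂ γ X : ℝ} (h1 : 0 < C₁) (h2 : 0 < C₂) (hγ : 0 < γ) (h a k : ℕ)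
    (hh : γ + 2 ≤ h * γ) (ha : 2 * (2 * C₂ + 8) ≤ C₁ * 2 ^ a) (hX : (2:ℝ) ^ (a + k) ≤ X) :
    2 + X * ((C₂ * X ^ γ + 2) * 2) + X * 2 ≤ C₁ * (X ^ h) ^ γ * (1 / 2) ^ (k + 1) := by
  have hX1 : 1 ≤ X := le_trans (one_le_pow₀ (by norm_num)) hX
  have hX0 : 0 < X := by linarith
  set Y := X ^ γ with hY
  have hY1 : 1 ≤ Y := Real.one_le_rpow hX1 hγ.le
  have hXY : X ≤ X * Y := le_mul_of_one_le_right hX0.le hY1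
  have e1 : Y * X ^ 2 ≤ (X ^ h) ^ γ := by
    rw [hY, ← Real.rpow_natCast X h, ← Real.rpow_mul hX0.le, ← Real.rpow_two,
      ← Real.rpow_add hX0]
    exact Real.rpow_le_rpow_of_exponent_le hX1 hh
  have e2 : 2 * C₂ + 8 ≤ C₁ * X * (1 / 2) ^ (k + 1) := by
    have : (2:ℝ) ^ (a + k) * (1 / 2) ^ (k + 1) = 2 ^ a / 2 := by
      rw [pow_add, pow_succ, one_div, inv_pow]
      field_simp
    calc 2 * C₂ + 8 ≤ C₁ * (2 ^ a / 2) := by linarith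
      _ = C₁ * (2 ^ (a + k)) * (1 / 2) ^ (k + 1) := by rw [← this]; ring
      _ ≤ _ := by gcongr
  calc 2 + X * ((C₂ * Y + 2) * 2) + X * 2 ≤ (2 * C₂ + 8) * (X * Y) := by nlinarith
    _ ≤ (C₁ * X * (1 / 2) ^ (k + 1)) * (X * Y) := by gcongr
    _ = C₁ * (Y * X ^ 2) * (1 / 2) ^ (k + 1) := by ring
    _ ≤ _ := by gcongr

lemma main_param (C₁ C₂ γ : ℝ) (h1 : 0 < C₁) (h2 : 0 < C₂) (hγ : 0 < γ)
    (t : ℕ → ℝ)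
    (ht : ∀ n : ℕ, 1 ≤ n → C₁ * (n : ℝ) ^ γ ≤ t n ∧ t n ≤ C₂ * (n : ℝ) ^ γ) :
    ∃ D > 0, ∃ n₀ : ℕ, 2 ≤ n₀ ∧ ∀ s : ℝ, 0 < s → s < 1 → ∃ η > 0, ∀ x ρ : ℕ → ℝ,
      (∀ i, 0 < ρ i) → Summable (fun i => ρ i ^ s) → ∑' i, ρ i ^ s ≤ η →
      ∃ ξ ∈ Icc (0:ℝ) 1, (∀ n : ℕ, n₀ ≤ n → ξ ∉ Bad (t n) (D / ((n:ℝ) * Real.log n))) ∧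
        ∀ i, ξ ∉ Ioo (x i - ρ i) (x i + ρ i) := by
  classical
  obtain ⟨h, hh2, hh⟩ : ∃ h : ℕ, 2 ≤ h ∧ γ + 2 ≤ h * γ := by
    obtain ⟨m, hm⟩ := exists_nat_ge ((γ + 2) / γ)
    refine ⟨m + 2, by omega, ?_⟩
    rw [div_le_iff₀ hγ] at hm
    push_cast
    nlinarith
  obtain ⟨a, ha1, ha⟩ : ∃ a : ℕ, 1 ≤ a ∧ 2 * (2 * C₂ + 8) ≤ C₁ * 2 ^ a := by
    obtain ⟨m, hm⟩ := pow_unbounded_of_one_lt (2 * (2 * C₂ + 8) / C₁) (one_lt_two)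
    refine ⟨m + 1, by omega, ?_⟩
    rw [div_lt_iff₀ h1] at hm
    have : (0:ℝ) < 2 ^ m := by positivity
    rw [pow_succ]
    nlinarith
  set u : ℕ → ℕ := fun k => a * h ^ k with hu
  have husucc : ∀ k, u (k + 1) = u k * h := fun k => by simp only [hu, pow_succ]; ring
  have hu1 : ∀ k, 1 ≤ u k := fun k => Nat.mul_pos ha1 (pow_pos (by omega) k)
  have humono : Monotone u := monotone_nat_of_le_succ fun k => by
    rw [husucc]; exact Nat.le_mul_of_pos_right _ (by omega)
  have hu2 : ∀ k, 2 ^ k ≤ u k := fun k =>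
    (Nat.pow_le_pow_left hh2 k).trans (Nat.le_mul_of_pos_left _ ha1)
  have huk : ∀ k, a + k ≤ u k := by
    intro k
    have e1 : k < 2 ^ k := Nat.lt_two_pow_self
    have e2 : 2 ^ k ≤ h ^ k := Nat.pow_le_pow_left hh2 k
    have : k + 1 ≤ h ^ k := by omega
    simp only [hu]
    nlinarith
  set N : ℕ → ℕ := fun k => 2 ^ u k with hN
  have hNmono : Monotone N := fun i j hij => Nat.pow_le_pow_right (by norm_num) (humono hij)
  have hN2 : ∀ k, 2 ≤ N k := fun k => by
    calc 2 = 2 ^ 1 := rfl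
      _ ≤ 2 ^ u k := Nat.pow_le_pow_right (by norm_num) (hu1 k)
  set D : ℝ := 1 / (24 * (h + 2)) with hD
  have hD0 : 0 < D := by positivity
  have hD1 : D ≤ 1 := by
    rw [hD, div_le_one (by positivity)]
    have : (0:ℝ) ≤ h := by positivity
    linarith
  have hnlog : ∀ n : ℕ, 2 ≤ n → 1 ≤ (n:ℝ) * Real.log n := by
    intro n hn
    have hn' : (2:ℝ) ≤ n := by exact_mod_cast hn
    have := Real.log_le_log (by norm_num) hn'
    have hl2 := Real.log_two_gt_d9
    nlinarith
  refine ⟨D, hD0, N 1, hN2 1, fun s hs0 hs1 => ?_⟩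
  -- the scales
  set r : ℕ → ℝ := fun k => (1 / 2 : ℝ) ^ u k with hr
  have hr0 : ∀ k, 0 < r k := fun k => by positivity
  have hr1 : ∀ k, r k ≤ 1 := fun k => pow_le_one₀ (by norm_num) (by norm_num)
  have hranti : Antitone r := fun i j hij =>
    pow_le_pow_of_le_one (by norm_num) (by norm_num) (humono hij)
  obtain ⟨k₀, hk₀1, hk₀⟩ : ∃ k₀ : ℕ, 1 ≤ k₀ ∧ ∀ k, k₀ ≤ k → (k + 3 : ℝ) ≤ (1 - s) * 2 ^ k := by
    have l1 : Filter.Tendsto (fun k : ℕ => ((k:ℝ) ^ 1 / 2 ^ k)) Filter.atTop (nhds 0) :=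
      tendsto_pow_const_div_const_pow_of_one_lt 1 (by norm_num)
    have ev := (l1.eventually (gt_mem_nhds (show 0 < (1 - s) / 4 by linarith)))
    obtain ⟨m, hm⟩ := Filter.eventually_atTop.1 ev
    refine ⟨m + 1, by omega, fun k hk => ?_⟩
    have := hm k (by omega)
    rw [div_lt_iff₀ (by positivity)] at this
    have hk1 : (1:ℝ) ≤ k := by exact_mod_cast (by omega : 1 ≤ k)
    nlinarith
  refine ⟨r k₀ ^ s, by have := hr0 k₀; positivity, fun x ρ hρ hsum htsum => ?_⟩
  have hη1 : r k₀ ^ s ≤ 1 := Real.rpow_le_one (hr0 _).le (hr1 _) hs0.le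
  have hnn : ∀ i, 0 ≤ ρ i ^ s := fun i => Real.rpow_nonneg (hρ i).le s
  have hfin_sum : ∀ F : Finset ℕ, ∑ i ∈ F, ρ i ^ s ≤ r k₀ ^ s := fun F =>
    (hsum.sum_le_tsum F fun i _ => hnn i).trans htsum
  have hρk₀ : ∀ i, ρ i ≤ r k₀ := by
    intro i
    have := hfin_sum {i}
    rw [Finset.sum_singleton] at this
    exact (Real.rpow_le_rpow_iff (hρ i).le (hr0 _).le hs0).1 this
  have hfinite : ∀ k, {i | r k < ρ i}.Finite := by
    intro k
    have hz := hsum.tendsto_cofinite_zero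
    have hrs : 0 < r k ^ s := Real.rpow_pos_of_pos (hr0 k) s
    have := hz.eventually (gt_mem_nhds hrs)
    rw [Filter.eventually_cofinite] at this
    refine this.subset fun i hi => ?_
    have hi : r k < ρ i := hi
    change ¬ (ρ i ^ s < r k ^ s)
    exact not_lt.2 (Real.rpow_le_rpow (hr0 k).le hi.le hs0.le)
  set F : ℕ → Finset ℕ := fun k => (hfinite k).toFinset with hF
  have hFmem : ∀ k i, i ∈ F k ↔ r k < ρ i := fun k i => by simp [hF]
  have hFmono : Monotone F := fun k l hkl i hi => by
    rw [hFmem] at *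
    exact (hranti hkl).trans_lt hi
  have hFempty : ∀ k, k ≤ k₀ → F k = ∅ := by
    intro k hk
    refine Finset.eq_empty_of_forall_notMem fun i hi => ?_
    rw [hFmem] at hi
    exact absurd (hρk₀ i) (not_le.2 ((hranti hk).trans_lt hi))
  have hFcard : ∀ k, ((F k).card : ℝ) ≤ N k := by
    intro k
    have e1 : ∑ i ∈ F k, r k ≤ 1 := by
      refine le_trans (Finset.sum_le_sum fun i hi => ?_) ((hfin_sum (F k)).trans hη1)
      rw [hFmem] at hi
      calc r k = r k ^ (1:ℝ) := (Real.rpow_one _).symm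
        _ ≤ r k ^ s := Real.rpow_le_rpow_of_exponent_ge (hr0 k) (hr1 k) hs1.le
        _ ≤ ρ i ^ s := Real.rpow_le_rpow (hr0 k).le hi.le hs0.le
    rw [Finset.sum_const, nsmul_eq_mul] at e1
    have e2 : r k * N k = 1 := by
      simp only [hr, hN]; push_cast
      rw [← mul_pow]; norm_num
    have e3 : (0:ℝ) < N k := by exact_mod_cast (by have := hN2 k; omega : 0 < N k)
    calc ((F k).card : ℝ) = ((F k).card * r k) * N k := by rw [mul_assoc, e2, mul_one]
      _ ≤ 1 * N k := by gcongr
      _ = _ := one_mul _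
  have hNle : ∀ n : ℕ, N 1 ≤ n → 2 ≤ n := fun n hn => (hN2 1).trans hn
  obtain ⟨ξ, hξ, hξ1, hξ2⟩ := core t (fun n => D / ((n:ℝ) * Real.log n)) N hNmono x ρ
    (fun i => (hρ i).le) F hFmono (hFempty 1 hk₀1)
    (fun n hn => by
      have hn := hNle n hn
      have hn0 : (0:ℝ) < n := by exact_mod_cast (by omega : 0 < n)
      exact lt_of_lt_of_le (by positivity) (ht n (by omega)).1)
    (fun n hn => by
      have := hnlog n (hNle n hn)
      refine ⟨by positivity, ?_⟩
      rw [div_le_one (by linarith)]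
      linarith)
    (fun k => C₁ * (N (k + 1) : ℝ) ^ γ)
    (fun k => by
      have : (0:ℝ) < N (k + 1) := by exact_mod_cast (by have := hN2 (k + 1); omega : 0 < N (k + 1))
      positivity)
    (fun k n hn => by
      have h3 := hN2 (k + 1)
      have hn1 : (N (k + 1) : ℝ) ≤ n := by exact_mod_cast hn
      refine le_trans ?_ (ht n (by omega)).1
      gcongr)
    (fun k => by
      have := sum_inv_mul_log (u (k + 1)) h (hu1 _)
      rw [← husucc] at this
      calc ∑ n ∈ Finset.Ico (N (k + 1)) (N (k + 2)), D / ((n:ℝ) * Real.log n)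
          = D * ∑ n ∈ Finset.Ico (N (k + 1)) (N (k + 2)), 1 / ((n:ℝ) * Real.log n) := by
            rw [Finset.mul_sum]
            exact Finset.sum_congr rfl fun n _ => by ring
        _ ≤ D * (h + 2) := by gcongr
        _ = 1 / 24 := by rw [hD]; field_simp)
    (fun k => by
      have hX : (2:ℝ) ^ (a + k) ≤ (N k : ℝ) := by
        simp only [hN]; push_cast
        exact pow_le_pow_right₀ (by norm_num) (huk k)
      have hb := cuts_bound h1 h2 hγ h a k hh ha hX
      have hNs : (N (k + 1) : ℝ) = (N k : ℝ) ^ h := by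
        simp only [hN, husucc]; push_cast
        rw [pow_mul]
      change _ ≤ C₁ * (N (k + 1) : ℝ) ^ γ * (1 / 2) ^ (k + 1)
      rw [hNs]
      refine le_trans ?_ hb
      push_cast
      have e1 : ∑ n ∈ Finset.Ico (N 1) (N k), (((⌊t n⌋₊ : ℝ) + 2) * 2)
          ≤ N k * ((C₂ * (N k : ℝ) ^ γ + 2) * 2) := by
        calc ∑ n ∈ Finset.Ico (N 1) (N k), (((⌊t n⌋₊ : ℝ) + 2) * 2)
            ≤ ∑ n ∈ Finset.Ico (N 1) (N k), ((C₂ * (N k : ℝ) ^ γ + 2) * 2) := by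
              refine Finset.sum_le_sum fun n hn => ?_
              rw [Finset.mem_Ico] at hn
              have hn2 := hNle n hn.1
              have htn := ht n (by omega)
              have hn0 : (0:ℝ) < n := by exact_mod_cast (by omega : 0 < n)
              have ht0 : 0 ≤ t n := le_trans (by positivity) htn.1
              have hnN : (n:ℝ) ≤ N k := by exact_mod_cast hn.2.le
              have h5 : (⌊t n⌋₊ : ℝ) ≤ C₂ * (N k : ℝ) ^ γ :=
                (Nat.floor_le ht0).trans (htn.2.trans (by gcongr))
              linarith
          _ = ((N k - N 1 : ℕ) : ℝ) * ((C₂ * (N k : ℝ) ^ γ + 2) * 2) := by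
              rw [Finset.sum_const, Nat.card_Ico, nsmul_eq_mul]
          _ ≤ _ := by
              gcongr
              exact Nat.sub_le _ _
      have e2 := hFcard k
      linarith)
    (fun k => by
      rcases le_or_gt (k + 2) k₀ with hk | hk
      · rw [hFempty _ hk]
        simp only [Finset.empty_sdiff, Finset.sum_empty]
        positivity
      · have hrs : r (k + 1) ^ (1 - s) ≤ (1 / 2 : ℝ) ^ (k + 4) := by
          simp only [hr]
          rw [← Real.rpow_natCast, ← Real.rpow_mul (by norm_num), ← Real.rpow_natCast]
          refine Real.rpow_le_rpow_of_exponent_ge (by norm_num) (by norm_num) ?_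
          have e1 := hk₀ (k + 1) (by omega)
          have e2 : (2:ℝ) ^ (k + 1) ≤ u (k + 1) := by exact_mod_cast hu2 (k + 1)
          push_cast at e1 ⊢
          nlinarith
        calc ∑ i ∈ F (k + 2) \ F (k + 1), 2 * ρ i
            ≤ ∑ i ∈ F (k + 2) \ F (k + 1), ρ i ^ s * (2 * (1 / 2 : ℝ) ^ (k + 4)) := by
              refine Finset.sum_le_sum fun i hi => ?_
              rw [Finset.mem_sdiff, hFmem (k + 1), not_lt] at hi
              have e1 : ρ i = ρ i ^ s * ρ i ^ (1 - s) := by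
                rw [← Real.rpow_add (hρ i)]; simp
              have e2 : ρ i ^ (1 - s) ≤ (1 / 2 : ℝ) ^ (k + 4) :=
                (Real.rpow_le_rpow (hρ i).le hi.2 (by linarith)).trans hrs
              calc 2 * ρ i = ρ i ^ s * (2 * ρ i ^ (1 - s)) := by
                    conv_lhs => rw [e1]
                    ring
                _ ≤ _ := by
                    have := hnn i
                    gcongr
          _ = (∑ i ∈ F (k + 2) \ F (k + 1), ρ i ^ s) * (2 * (1 / 2 : ℝ) ^ (k + 4)) := by
              rw [Finset.sum_mul]
          _ ≤ 1 * (2 * (1 / 2 : ℝ) ^ (k + 4)) := by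
              gcongr
              exact (hfin_sum _).trans hη1
          _ = (1 / 2 : ℝ) ^ (k + 3) := by ring)
  refine ⟨ξ, hξ, fun n hn => ?_, fun i => ?_⟩
  · refine hξ1 n n (Finset.mem_Ico.2 ⟨hn, ?_⟩)
    calc n < 2 ^ n := Nat.lt_two_pow_self
      _ ≤ 2 ^ u n := Nat.pow_le_pow_right (by norm_num) (by have := huk n; omega)
  · obtain ⟨k, hk⟩ := exists_pow_lt_of_lt_one (hρ i) (show (1 / 2 : ℝ) < 1 by norm_num)
    refine hξ2 k i ((hFmem k i).2 (lt_of_le_of_lt ?_ hk))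
    exact pow_le_pow_of_le_one (by norm_num) (by norm_num) (by have := huk k; omega)

theorem stmt_17 (C₁ C₂ γ : ℝ) (h1 : 0 < C₁) (h2 : 0 < C₂) (hγ : 0 < γ)
    (t : ℕ → ℝ)
    (ht : ∀ n : ℕ, 1 ≤ n → C₁ * (n : ℝ) ^ γ ≤ t n ∧ t n ≤ C₂ * (n : ℝ) ^ γ) :
    ∃ C > 0, ∃ n₀ : ℕ,
      dimH {ξ : ℝ | ∀ n : ℕ, n₀ ≤ n →
        C / ((n : ℝ) * Real.log n) < nint (ξ * t n)} = 1 := by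
  obtain ⟨D, hD, n₀, hn₀, hmain⟩ := main_param C₁ C₂ γ h1 h2 hγ t ht
  refine ⟨D / 2, by positivity, n₀, le_antisymm ?_ ?_⟩
  · exact (dimH_mono (subset_univ _)).trans Real.dimH_univ.le
  refine le_of_forall_lt_imp_le_of_dense fun c hc => ?_
  obtain ⟨s, hcs, hs1⟩ := ENNReal.lt_iff_exists_nnreal_btwn.1 hc
  refine hcs.le.trans ?_
  have hs1 : s < 1 := by exact_mod_cast hs1
  have hs0 : 0 < s := by
    have : (0 : ENNReal) < s := lt_of_le_of_lt zero_le hcs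
    exact_mod_cast this
  have hs0' : (0:ℝ) < s := by exact_mod_cast hs0
  obtain ⟨η, hη, hcov⟩ := hmain s hs0' (by exact_mod_cast hs1)
  refine le_dimH_of_hausdorffMeasure_ne_zero ?_
  intro hzero
  rw [Measure.hausdorffMeasure_apply] at hzero
  have hz1 := (ENNReal.iSup_eq_zero.1 hzero) 1
  have hz2 := (ENNReal.iSup_eq_zero.1 hz1) one_pos
  have hη2 : (0 : ENNReal) < ENNReal.ofReal (η / 2) := by
    rw [ENNReal.ofReal_pos]; linarith
  rw [← hz2] at hη2
  simp only [iInf_lt_iff] at hη2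
  obtain ⟨U, hU, hUd, hUs⟩ := hη2
  set d : ℕ → ℝ := fun i => (⨆ _ : (U i).Nonempty, Metric.ediam (U i) ^ (s:ℝ)).toReal with hd
  have hne : ∑' i, (⨆ _ : (U i).Nonempty, Metric.ediam (U i) ^ (s:ℝ)) ≠ ⊤ :=
    (hUs.trans ENNReal.ofReal_lt_top).ne
  have hd0 : ∀ i, 0 ≤ d i := fun i => ENNReal.toReal_nonneg
  have hds : Summable d := ENNReal.summable_toReal hne
  have hdt : ∑' i, d i ≤ η / 2 := by
    rw [hd, ← ENNReal.tsum_toReal_eq (fun i => ENNReal.ne_top_of_tsum_ne_top hne i)]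
    exact ENNReal.toReal_le_of_le_ofReal (by linarith) hUs.le
  set w : ℕ → ℝ := fun i => η / 2 / 2 / 2 ^ i with hw
  have hwp : ∀ i, 0 < w i := fun i => by positivity
  have hws : HasSum w (η / 2) := hasSum_geometric_two' (η / 2)
  set ρ : ℕ → ℝ := fun i => (d i + w i) ^ ((s:ℝ)⁻¹) with hρ
  have hρs : ∀ i, ρ i ^ (s:ℝ) = d i + w i := fun i =>
    Real.rpow_inv_rpow (by linarith [hd0 i, hwp i]) hs0'.ne'
  have hρ0 : ∀ i, 0 < ρ i := fun i => Real.rpow_pos_of_pos (by linarith [hd0 i, hwp i]) _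
  classical
  set x : ℕ → ℝ := fun i => if h : (U i).Nonempty then h.some else 0 with hx
  obtain ⟨ξ, hξ, hξ1, hξ2⟩ := hcov x ρ hρ0 (by simp only [hρs]; exact hds.add hws.summable) (by
    simp only [hρs]
    rw [hds.tsum_add hws.summable, hws.tsum_eq]
    linarith)
  have hmem : ξ ∈ ⋃ i, U i := by
    refine hU fun n hn => ?_
    have h3 := hξ1 n hn
    have h3 : D / ((n:ℝ) * Real.log n) ≤ nint (ξ * t n) := not_lt.1 h3
    refine lt_of_lt_of_le ?_ h3
    have hn2 : (2:ℝ) ≤ n := by exact_mod_cast hn₀.trans hn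
    have hlog : 0 < Real.log n := Real.log_pos (by linarith)
    gcongr
    linarith
  obtain ⟨i, hi⟩ := mem_iUnion.1 hmem
  have hUi : (U i).Nonempty := ⟨ξ, hi⟩
  have hxi : x i ∈ U i := by
    simp only [hx, dif_pos hUi]; exact hUi.some_mem
  have hdist : dist ξ (x i) < ρ i := by
    have hb : Metric.ediam (U i) ≠ ⊤ := ((hUd i).trans_lt ENNReal.one_lt_top).ne
    have e1 : edist ξ (x i) ≤ Metric.ediam (U i) := Metric.edist_le_ediam_of_mem hi hxi
    have e2 : dist ξ (x i) ≤ (Metric.ediam (U i)).toReal := by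
      rw [dist_edist]; exact ENNReal.toReal_mono hb e1
    have e3 : d i = (Metric.ediam (U i)).toReal ^ (s:ℝ) := by
      simp only [hd, hUi, iSup_pos, ENNReal.toReal_rpow]
    refine e2.trans_lt ?_
    rw [← Real.rpow_lt_rpow_iff ENNReal.toReal_nonneg (hρ0 i).le hs0', hρs, ← e3]
    linarith [hwp i]
  refine hξ2 i ?_
  rw [Real.dist_eq, abs_lt] at hdist
  constructor <;> linarith [hdist.1, hdist.2]
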